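/- Let 𝒯=(V,ℰ) be a leafless, locally finite rooted directed tree, q ≥ 1 a real number, and S_{λ,q} the Dirichlet shift on ℓ²(V). Then the operator S_{λ,q}*S_{λ,q} is invertible, and the Cauchy dual S'_{λ,q} := S_{λ,q}(S_{λ,q}*S_{λ,q})^{-1} is the weighted shift on 𝒯 with weights λ'_{u,q} = (1/√(card Chi(v)))·√((n_v+1)/(n_v+q)) for u ∈ Chi(v); that is, S'_{λ,q} e_v = Σ_{u∈Chi(v)} (1/√(card Chi(v)))·√((n_v+1)/(n_v+q)) e_u for every v ∈ V. -/

import Mathlib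

open scoped ENNReal InnerProductSpace
open ContinuousLinearMap

noncomputable section

/-- A (countably infinite) rooted directed tree. -/
structure DirTree (V : Type) where
  edge : V → V → Prop
  not_self : ∀ v, ¬ edge v v
  no_circuit : ∀ v, ¬ Relation.TransGen edge v v
  connected : ∀ u v : V, Relation.ReflTransGen (fun a b => edge a b ∨ edge b a) u v
  uniq_parent : ∀ {u w v : V}, edge u v → edge w v → u = w
  root : V
  root_no_parent : ∀ u, ¬ edge u root
  root_uniq : ∀ v, (∀ u, ¬ edge u v) → v = root

namespace DirTree

variable {V : Type} (T : DirTree V)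

/-- The set of children of a vertex. -/
def chi (v : V) : Set V := {u | T.edge v u}

/-- Leafless: every vertex has a child. -/
def Leafless : Prop := ∀ v : V, ∃ u, T.edge v u

/-- Locally finite: every vertex has finitely many children. -/
def LocFin : Prop := ∀ v : V, (T.chi v).Finite

/-- The finset of children of a vertex (locally finite case). -/
def chiFin (hT : T.LocFin) (v : V) : Finset V := (hT v).toFinset

/-- Iterated child sets `Chi^⟨n⟩(W)`. -/
def chiIter (T : DirTree V) : ℕ → Set V → Set V
  | 0, W => W
  | n + 1, W => {u | ∃ v ∈ chiIter T n W, T.edge v u}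

/-- The depth of a vertex: the unique `n` with `v ∈ Chi^⟨n⟩(root)`. -/
def depth (v : V) : ℕ := sInf {n | v ∈ T.chiIter n {T.root}}

/-- The parent map (junk value at the root). -/
def par (v : V) : V :=
  letI := Classical.propDecidable (∃ u, T.edge u v)
  if h : ∃ u, T.edge u v then h.choose else v

end DirTree

/-- `ℓ²(V)`. -/
abbrev l2 (V : Type) := lp (fun _ : V => ℂ) 2

/-- The standard orthonormal basis vector `e_v` of `ℓ²(V)`. -/
def evec {V : Type} (v : V) : l2 V :=
  letI := Classical.decEq V
  lp.single 2 v 1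

/-- The Pochhammer symbol `(x)_k = x (x+1) ⋯ (x+k-1)`. -/
def poch (x : ℝ) (k : ℕ) : ℝ := ∏ i ∈ Finset.range k, (x + i)

namespace DirTree

variable {V : Type} (T : DirTree V)

/-- The weight `λ_{u,q}` (for any child `u` of `v`). -/
def wt (hT : T.LocFin) (q : ℝ) (v : V) : ℝ :=
  Real.sqrt (((T.depth v : ℝ) + q) / ((T.depth v : ℝ) + 1)) /
    Real.sqrt ((T.chiFin hT v).card)

/-- `S` is the Dirichlet shift with parameter `q` on `ℓ²(V)`:
`S e_v = ∑_{u ∈ Chi(v)} λ_{u,q} e_u`. -/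
def IsDirichletShift (hT : T.LocFin) (q : ℝ) (S : l2 V →L[ℂ] l2 V) : Prop :=
  ∀ v : V, S (evec v) = ∑ u ∈ T.chiFin hT v, ((T.wt hT q v : ℝ) : ℂ) • evec u

end DirTree

/-- The Cauchy dual `S (S*S)⁻¹` of a left-invertible operator. -/
def cauchyDual {V : Type} (S : l2 V →L[ℂ] l2 V) : l2 V →L[ℂ] l2 V :=
  S * Ring.inverse (ContinuousLinearMap.adjoint S * S)

section Evec

variable {V : Type}

theorem inner_evec_left (v : V) (x : l2 V) : ⟪evec v, x⟫_ℂ = x v := by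
  classical
  rw [evec, lp.inner_single_left]
  simp

theorem inner_evec_evec [DecidableEq V] (u v : V) :
    ⟪evec u, evec v⟫_ℂ = if u = v then 1 else 0 := by
  let _ := Classical.decEq V
  rw [inner_evec_left, evec, lp.coeFn_single]
  by_cases h : u = v
  · subst h
    simp
  · simp [h]

theorem apply_eq_of_adjoint_comp_evec (S : l2 V →L[ℂ] l2 V) (d : V → ℝ)
    (hd : ∀ v, (adjoint S * S) (evec v) = (d v : ℂ) • evec v) (x : l2 V) (v : V) :
    ((adjoint S * S) x : l2 V) v = (d v : ℂ) * x v := by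
  have h : ⟪(adjoint S * S) (evec v), x⟫_ℂ = ⟪evec v, (adjoint S * S) x⟫_ℂ := by
    simp only [mul_apply_eq_comp, adjoint_inner_left, adjoint_inner_right]
  rw [← inner_evec_left, ← h, hd, inner_smul_left, inner_evec_left, Complex.conj_ofReal]

/-- If `S*S` is diagonal with all diagonal entries at least `1`, then it is invertible. -/
theorem isUnit_adjoint_mul_self_of_diagonal (S : l2 V →L[ℂ] l2 V) (d : V → ℝ)
    (hd : ∀ v, (adjoint S * S) (evec v) = (d v : ℂ) • evec v) (hd1 : ∀ v, 1 ≤ d v) :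
    IsUnit (adjoint S * S) := by
  refine isUnit_of_forall_le_norm_inner_map _ (c := 1) one_pos fun x => ?_
  have h1 := (lp.hasSum_inner ((adjoint S * S) x) x).mapL Complex.reCLM
  have h2 := (lp.hasSum_inner x x).mapL Complex.reCLM
  have h3 := hasSum_le (fun v => ?_) h2 h1
  · have h4 : ‖x‖ ^ 2 = (⟪x, x⟫_ℂ).re := (inner_self_eq_norm_sq (𝕜 := ℂ) x).symm
    simp only [NNReal.coe_one, mul_one]
    exact (h4.trans_le h3).trans (Complex.re_le_norm _)
  · rw [apply_eq_of_adjoint_comp_evec S d hd]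
    have h5 : (⟪x v, x v⟫_ℂ).re = ‖x v‖ ^ 2 := inner_self_eq_norm_sq (𝕜 := ℂ) (x v)
    have h6 : ⟪(d v : ℂ) * x v, x v⟫_ℂ = (d v : ℂ) * ⟪x v, x v⟫_ℂ := by
      rw [← smul_eq_mul, inner_smul_left, Complex.conj_ofReal]
    simp only [Complex.reCLM_apply, h6, Complex.re_ofReal_mul, h5]
    exact le_mul_of_one_le_left (sq_nonneg _) (hd1 v)

end Evec

namespace DirTree

variable {V : Type} (T : DirTree V)

theorem mem_chiFin (hT : T.LocFin) {u v : V} : u ∈ T.chiFin hT v ↔ T.edge v u := by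
  simp [chiFin, chi]

theorem card_chiFin_pos (hL : T.Leafless) (hT : T.LocFin) (v : V) :
    0 < (T.chiFin hT v).card := by
  obtain ⟨u, hu⟩ := hL v
  exact Finset.card_pos.2 ⟨u, (T.mem_chiFin hT).2 hu⟩

theorem inner_sum_chiFin [DecidableEq V] (hT : T.LocFin) (u v : V) :
    ⟪∑ a ∈ T.chiFin hT u, evec a, ∑ b ∈ T.chiFin hT v, evec b⟫_ℂ =
      if u = v then ((T.chiFin hT v).card : ℂ) else 0 := by
  simp only [sum_inner, inner_sum, inner_evec_evec, Finset.sum_ite_eq']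
  split_ifs with h
  · subst h
    simp
  · refine Finset.sum_eq_zero fun a ha => if_neg fun hb => h ?_
    exact T.uniq_parent ((T.mem_chiFin hT).1 hb) ((T.mem_chiFin hT).1 ha)

theorem IsDirichletShift.adjoint_mul_self_evec {T : DirTree V} {hT : T.LocFin} {q : ℝ}
    {S : l2 V →L[ℂ] l2 V} (hS : T.IsDirichletShift hT q S) (hL : T.Leafless) (hq : 0 ≤ q)
    (v : V) :
    (adjoint S * S) (evec v) =
      ((((T.depth v : ℝ) + q) / ((T.depth v : ℝ) + 1) : ℝ) : ℂ) • evec v := by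
  classical
  ext u
  rw [← inner_evec_left, ← inner_evec_left, mul_apply_eq_comp, adjoint_inner_right, hS, hS,
    ← Finset.smul_sum, ← Finset.smul_sum, inner_smul_left, inner_smul_right, inner_smul_right,
    inner_sum_chiFin, inner_evec_evec, Complex.conj_ofReal]
  split_ifs with h
  · subst h
    have hc : (0 : ℝ) < (T.chiFin hT u).card := by exact_mod_cast T.card_chiFin_pos hL hT u
    have hw : T.wt hT q u * (T.wt hT q u * (T.chiFin hT u).card) =
        ((T.depth u : ℝ) + q) / ((T.depth u : ℝ) + 1) := by
      rw [← mul_assoc, ← sq, wt, div_pow, Real.sq_sqrt (by positivity), Real.sq_sqrt hc.le,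
        div_mul_cancel₀ _ hc.ne']
    rw [mul_one, ← hw]
    push_cast
    rfl
  · simp

end DirTree

theorem stmt_2 {V : Type} [Countable V] [Infinite V] (T : DirTree V)
    (hL : T.Leafless) (hT : T.LocFin) (q : ℝ) (hq : 1 ≤ q)
    (S : l2 V →L[ℂ] l2 V) (hS : T.IsDirichletShift hT q S) :
    IsUnit (ContinuousLinearMap.adjoint S * S) ∧
      ∀ v : V, cauchyDual S (evec v) =
        ∑ u ∈ T.chiFin hT v,
          ((Real.sqrt (((T.depth v : ℝ) + 1) / ((T.depth v : ℝ) + q)) /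
              Real.sqrt ((T.chiFin hT v).card) : ℝ) : ℂ) • evec u := by
  have hq0 : 0 < q := one_pos.trans_le hq
  have hd := hS.adjoint_mul_self_evec hL hq0.le
  have hunit : IsUnit (adjoint S * S) :=
    isUnit_adjoint_mul_self_of_diagonal S _ hd fun v => by
      rw [one_le_div (by positivity)]
      linarith
  refine ⟨hunit, fun v => ?_⟩
  have hn : (0 : ℝ) < (T.depth v : ℝ) + 1 := by positivity
  have hnq : (0 : ℝ) < (T.depth v : ℝ) + q := by positivity
  set d : ℝ := ((T.depth v : ℝ) + q) / ((T.depth v : ℝ) + 1) with hd_def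
  have hdpos : 0 < d := div_pos hnq hn
  have hinv : Ring.inverse (adjoint S * S) (evec v) = ((d⁻¹ : ℝ) : ℂ) • evec v := by
    have h1 : evec v = ((d⁻¹ : ℝ) : ℂ) • (adjoint S * S) (evec v) := by
      rw [hd, smul_smul, ← Complex.ofReal_mul, inv_mul_cancel₀ hdpos.ne', Complex.ofReal_one,
        one_smul]
    conv_lhs => rw [h1]
    rw [map_smul, ← mul_apply_eq_comp, Ring.inverse_mul_cancel _ hunit, one_apply_eq_self]
  have hweight : d⁻¹ * T.wt hT q v =
      Real.sqrt (((T.depth v : ℝ) + 1) / ((T.depth v : ℝ) + q)) /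
        Real.sqrt ((T.chiFin hT v).card) := by
    rw [DirTree.wt, ← hd_def, ← inv_div (_ + q), ← hd_def, Real.sqrt_inv, ← mul_div_assoc]
    congr 1
    have hs := Real.sqrt_pos.2 hdpos
    field_simp
    rw [Real.sq_sqrt hdpos.le]
  rw [cauchyDual, mul_apply_eq_comp, hinv, map_smul, hS, Finset.smul_sum]
  refine Finset.sum_congr rfl fun u _ => ?_
  rw [smul_smul, ← Complex.ofReal_mul, hweight]

end
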